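/- Let Y₁⁺,…,Y_N⁺, Y₁⁻,…,Y_N⁻ be independent random variables each with the k-truncated Poisson distribution TPo_k(λ), where k is a fixed positive integer and 0 < λ ≤ log N, and let c = E[Y₁⁺]. Then for any t ≥ √N (log N)³, P(|Σ_{i=1}^N Y_i⁺ Y_i⁻ − c²N| > t) = O(exp(−(t²/(8N))^{1/5})) as N → ∞. -/

import Mathlib

/-- `fk k x = ∑_{i ≥ k} x^i / i!`. -/
noncomputable def fk (k : ℕ) (x : ℝ) : ℝ :=
  ∑' i : ℕ, if k ≤ i then x ^ i / (Nat.factorial i : ℝ) else 0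

lemma mul_sub_min_mul_min_le {a b D : ℝ} (ha : 0 ≤ a) (hb : 0 ≤ b) (hD : 0 ≤ D) :
    0 ≤ a * b - min a D * min b D ∧
    a * b - min a D * min b D ≤
      Real.exp (-4 * D) * (Real.exp (5 * a) * Real.exp (5 * b)) ∧
    (D < a ∨ D < b → 1 ≤ Real.exp (-4 * D) * (Real.exp (5 * a) * Real.exp (5 * b))) := by
  have hg : 0 ≤ min a D * min b D := by positivity
  have h1 : min a D * min b D ≤ a * b := by
    gcongr <;> exact min_le_left _ _
  have hexp : D < a ∨ D < b →
      Real.exp (a + b) ≤ Real.exp (-4 * D) * (Real.exp (5 * a) * Real.exp (5 * b)) := by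
    intro h
    rw [← Real.exp_add, ← Real.exp_add]
    apply Real.exp_le_exp.mpr
    rcases h with h | h <;> linarith
  refine ⟨by linarith, ?_, fun h => (Real.one_le_exp (by positivity)).trans (hexp h)⟩
  by_cases h : D < a ∨ D < b
  · have ha' := Real.add_one_le_exp a
    have hb' := Real.add_one_le_exp b
    have : a * b ≤ Real.exp (a + b) := by
      rw [Real.exp_add]
      gcongr <;> linarith
    linarith [hexp h]
  · push Not at h
    rw [min_eq_left h.1, min_eq_left h.2, sub_self]
    positivity

open MeasureTheory ProbabilityTheory in
/-- Hoeffding's inequality for a function of the coordinates of a product space. -/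
lemma measureReal_sum_sub_integral_ge_le {α : Type*} [MeasurableSpace α] (ρ : Measure α)
    [IsProbabilityMeasure ρ] (N : ℕ) {g : α → ℝ} (hg : Measurable g) {a b : ℝ}
    (hgb : ∀ x, g x ∈ Set.Icc a b) {ε : ℝ} (hε : 0 ≤ ε) :
    (Measure.pi fun _ : Fin N => ρ).real {ω | ε ≤ ∑ i, (g (ω i) - ∫ x, g x ∂ρ)} ≤
      Real.exp (-ε ^ 2 / (2 * (N * ((b - a) / 2) ^ 2))) := by
  have hsub (i : Fin N) : HasSubgaussianMGF (fun ω : Fin N → α => g (ω i) - ∫ x, g x ∂ρ)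
      ((‖b - a‖₊ / 2) ^ 2) (Measure.pi fun _ : Fin N => ρ) := by
    have := hasSubgaussianMGF_of_mem_Icc (μ := Measure.pi fun _ : Fin N => ρ)
      (X := fun ω : Fin N → α => g (ω i)) (a := a) (b := b)
      (hg.comp (measurable_pi_apply i)).aemeasurable (ae_of_all _ fun ω => hgb _)
    rwa [integral_comp_eval (μ := fun _ : Fin N => ρ) hg.aestronglyMeasurable] at this
  have hind : iIndepFun (fun (i : Fin N) (ω : Fin N → α) => g (ω i) - ∫ x, g x ∂ρ)
      (Measure.pi fun _ : Fin N => ρ) :=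
    iIndepFun_pi (X := fun _ x => g x - ∫ x, g x ∂ρ)
      fun i => (hg.sub_const _).aemeasurable
  refine (HasSubgaussianMGF.measure_sum_ge_le_of_iIndepFun hind (s := Finset.univ)
    (fun i _ => hsub i) hε).trans_eq ?_
  simp [div_pow]

open MeasureTheory ProbabilityTheory in
lemma measureReal_abs_sum_mul_sub_gt_le (ν : Measure ℕ) [IsProbabilityMeasure ν] (N : ℕ)
    {D t : ℝ} (hD : 0 ≤ D) (ht : 0 ≤ t)
    (hint : Integrable (fun n : ℕ => Real.exp (5 * n)) ν)
    (hq : N * (Real.exp (-4 * D) * (∫ n : ℕ, Real.exp (5 * n) ∂ν) ^ 2) ≤ t / 2) :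
    (Measure.pi fun _ : Fin N => ν.prod ν).real
      {ω | t < |(∑ i, ((ω i).1 : ℝ) * ((ω i).2 : ℝ)) - (∫ n : ℕ, (n : ℝ) ∂ν) ^ 2 * N|} ≤
    N * (Real.exp (-4 * D) * (∫ n : ℕ, Real.exp (5 * n) ∂ν) ^ 2) +
      2 * Real.exp (-(t / 2) ^ 2 / (2 * (N * (D ^ 2 / 2) ^ 2))) := by
  set ρ := ν.prod ν with hρ
  set μ := Measure.pi fun _ : Fin N => ρ with hμ
  let h : ℕ × ℕ → ℝ := fun x =>
    Real.exp (-4 * D) * (Real.exp (5 * (x.1 : ℝ)) * Real.exp (5 * (x.2 : ℝ)))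
  let g : ℕ × ℕ → ℝ := fun x => min (x.1 : ℝ) D * min (x.2 : ℝ) D
  have hpt (x : ℕ × ℕ) := mul_sub_min_mul_min_le (Nat.cast_nonneg (α := ℝ) x.1)
    (Nat.cast_nonneg (α := ℝ) x.2) hD
  have hh0 (x : ℕ × ℕ) : 0 ≤ h x := by positivity
  have hh_int : Integrable h ρ := (hint.mul_prod hint).const_mul _
  have hh_eq : ∫ x, h x ∂ρ = Real.exp (-4 * D) * (∫ n : ℕ, Real.exp (5 * n) ∂ν) ^ 2 := by
    simp only [h]
    rw [integral_const_mul, integral_prod_mul (fun n : ℕ => Real.exp (5 * (n : ℝ)))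
      (fun n : ℕ => Real.exp (5 * (n : ℝ))), sq]
  have hid_int : Integrable (fun n : ℕ => (n : ℝ)) ν := by
    refine hint.mono' (measurable_of_countable _).aestronglyMeasurable (ae_of_all _ fun n => ?_)
    have := Real.add_one_le_exp (5 * (n : ℝ))
    have hn : (0 : ℝ) ≤ n := n.cast_nonneg
    rw [Real.norm_eq_abs, abs_of_nonneg hn]
    linarith
  have hmul_int : Integrable (fun x : ℕ × ℕ => (x.1 : ℝ) * (x.2 : ℝ)) ρ :=
    hid_int.mul_prod hid_int
  have hg_mem (x : ℕ × ℕ) : g x ∈ Set.Icc 0 (D ^ 2) := by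
    refine ⟨by positivity, ?_⟩
    rw [sq]
    exact mul_le_mul (min_le_right _ _) (min_le_right _ _) (by positivity) hD
  have hg_int : Integrable g ρ :=
    Integrable.of_mem_Icc 0 (D ^ 2) (measurable_of_countable _).aemeasurable (ae_of_all _ hg_mem)
  have hmean : (∫ n : ℕ, (n : ℝ) ∂ν) ^ 2 - ∫ x, g x ∂ρ =
      ∫ x : ℕ × ℕ, ((x.1 : ℝ) * (x.2 : ℝ) - g x) ∂ρ := by
    rw [integral_sub hmul_int hg_int,
      integral_prod_mul (fun n : ℕ => (n : ℝ)) (fun n : ℕ => (n : ℝ)), sq]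
  have hmean0 : 0 ≤ (∫ n : ℕ, (n : ℝ) ∂ν) ^ 2 - ∫ x, g x ∂ρ := by
    rw [hmean]
    exact integral_nonneg fun x => (hpt x).1
  have hmean1 : (∫ n : ℕ, (n : ℝ) ∂ν) ^ 2 - ∫ x, g x ∂ρ ≤ ∫ x, h x ∂ρ := by
    rw [hmean]
    exact integral_mono (hmul_int.sub hg_int) hh_int fun x => (hpt x).2.1
  have hA : μ.real {ω | 1 ≤ ∑ i, h (ω i)} ≤ N * ∫ x, h x ∂ρ := by
    have hi (i : Fin N) : Integrable (fun ω : Fin N → ℕ × ℕ => h (ω i)) μ :=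
      integrable_comp_eval (μ := fun _ : Fin N => ρ) hh_int
    have := mul_meas_ge_le_integral_of_nonneg (μ := μ) (f := fun ω => ∑ i, h (ω i))
      (ae_of_all _ fun ω => Finset.sum_nonneg fun i _ => hh0 _)
      (integrable_finsetSum _ fun i _ => hi i) 1
    rw [one_mul, integral_finsetSum _ fun i _ => hi i] at this
    simpa [hμ, integral_comp_eval (μ := fun _ : Fin N => ρ) hh_int.aestronglyMeasurable] using this
  have hB := measureReal_sum_sub_integral_ge_le ρ N (measurable_of_countable g) hg_mem
    (ε := t / 2) (by positivity)
  have hC := measureReal_sum_sub_integral_ge_le ρ N (measurable_of_countable fun x => -g x)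
    (a := -D ^ 2) (b := 0) (fun x => ⟨by linarith [(hg_mem x).2], by linarith [(hg_mem x).1]⟩)
    (ε := t / 2) (by positivity)
  have hsub : {ω : Fin N → ℕ × ℕ |
        t < |(∑ i, ((ω i).1 : ℝ) * ((ω i).2 : ℝ)) - (∫ n : ℕ, (n : ℝ) ∂ν) ^ 2 * N|} ⊆
      {ω | 1 ≤ ∑ i, h (ω i)} ∪ ({ω | t / 2 ≤ ∑ i, (g (ω i) - ∫ x, g x ∂ρ)} ∪
        {ω | t / 2 ≤ ∑ i, (-g (ω i) - ∫ x, -g x ∂ρ)}) := by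
    intro ω hω
    simp only [Set.mem_union, Set.mem_ofPred_eq] at hω ⊢
    by_contra! hcon
    obtain ⟨h1, h2, h3⟩ := hcon
    have hle (i : Fin N) : ((ω i).1 : ℝ) ≤ D ∧ ((ω i).2 : ℝ) ≤ D := by
      by_contra hc
      have := (hpt (ω i)).2.2 (by rwa [not_and_or, not_le, not_le] at hc)
      exact absurd h1 (not_lt.mpr (le_trans this
        (Finset.single_le_sum (f := fun i => h (ω i)) (fun i _ => hh0 _) (Finset.mem_univ i))))
    have hsum : ∑ i, ((ω i).1 : ℝ) * ((ω i).2 : ℝ) = ∑ i, g (ω i) :=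
      Finset.sum_congr rfl fun i _ => by
        simp only [g]
        rw [min_eq_left (hle i).1, min_eq_left (hle i).2]
    rw [integral_neg, Finset.sum_sub_distrib, Finset.sum_neg_distrib] at h3
    rw [Finset.sum_sub_distrib] at h2
    simp only [Finset.sum_const, Finset.card_univ, Fintype.card_fin, nsmul_eq_mul] at h2 h3
    have hN : (0 : ℝ) ≤ N := N.cast_nonneg
    rw [← hh_eq] at hq
    have e1 := mul_le_mul_of_nonneg_left hmean1 hN
    have e0 := mul_nonneg hN hmean0
    rw [hsum, lt_abs] at hω
    rcases hω with hω | hω <;> nlinarith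
  calc _ ≤ _ := measureReal_mono hsub
    _ ≤ _ := (measureReal_union_le _ _).trans
      (add_le_add le_rfl (measureReal_union_le _ _))
    _ ≤ _ := by
      rw [← hh_eq]
      have e1 : (D ^ 2 - 0 : ℝ) = D ^ 2 := by ring
      have e2 : (0 - -D ^ 2 : ℝ) = D ^ 2 := by ring
      rw [e1] at hB
      rw [e2] at hC
      linarith

lemma summable_fk (k : ℕ) (x : ℝ) :
    Summable fun i : ℕ => if k ≤ i then x ^ i / (Nat.factorial i : ℝ) else 0 := by
  convert! (Real.summable_pow_div_factorial x).indicator {i | k ≤ i} using 2 with i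
  simp [Set.indicator_apply]

lemma pow_div_factorial_le_fk (k : ℕ) {x : ℝ} (hx : 0 ≤ x) :
    x ^ k / (Nat.factorial k : ℝ) ≤ fk k x := by
  simpa [fk] using (summable_fk k x).le_tsum k fun i _ => by positivity

lemma fk_pos (k : ℕ) {x : ℝ} (hx : 0 < x) : 0 < fk k x :=
  lt_of_lt_of_le (by positivity) (pow_div_factorial_le_fk k hx.le)

lemma fk_le (k : ℕ) {x : ℝ} (hx : 0 ≤ x) :
    fk k x ≤ x ^ k / (Nat.factorial k : ℝ) * Real.exp x := by
  have hshift : fk k x = ∑' j : ℕ, x ^ (j + k) / (Nat.factorial (j + k) : ℝ) := by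
    rw [fk, ← (summable_fk k x).sum_add_tsum_nat_add k, Finset.sum_eq_zero, zero_add]
    · simp
    · intro i hi
      rw [if_neg (not_le.mpr (Finset.mem_range.mp hi))]
  rw [hshift, Real.exp_eq_exp_ℝ, NormedSpace.exp_eq_tsum_div, ← tsum_mul_left]
  refine Summable.tsum_le_tsum (fun j => ?_)
    ((summable_nat_add_iff k).mpr (Real.summable_pow_div_factorial x))
    ((Real.summable_pow_div_factorial x).mul_left _)
  rw [div_mul_div_comm, ← pow_add, add_comm k j]
  gcongr
  rw [mul_comm]
  exact_mod_cast Nat.le_of_dvd (Nat.factorial_pos _) (Nat.factorial_mul_factorial_dvd_factorial_add j k)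

/-- The probability mass function of the `k`-truncated Poisson distribution. -/
noncomputable def truncPoissonWeight (k : ℕ) (l : ℝ) (j : ℕ) : ℝ :=
  if k ≤ j then l ^ j / (fk k l * (Nat.factorial j : ℝ)) else 0

/-- The `k`-truncated Poisson distribution. -/
noncomputable def truncPoisson (k : ℕ) (l : ℝ) : MeasureTheory.Measure ℕ :=
  .sum fun j => ENNReal.ofReal (truncPoissonWeight k l j) • .dirac j

lemma truncPoissonWeight_nonneg (k : ℕ) {l : ℝ} (hl : 0 < l) (j : ℕ) :
    0 ≤ truncPoissonWeight k l j := by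
  have := fk_pos k hl
  unfold truncPoissonWeight
  positivity

lemma hasSum_truncPoissonWeight_mul_pow (k : ℕ) (l z : ℝ) :
    HasSum (fun j => truncPoissonWeight k l j * z ^ j) (fk k (z * l) / fk k l) := by
  rw [fk]
  convert! (summable_fk k (z * l)).hasSum.div_const (fk k l) using 2 with j
  unfold truncPoissonWeight
  split_ifs
  · rw [mul_pow, div_div, mul_comm (fk k l)]
    ring
  · simp

lemma integral_truncPoisson (k : ℕ) {l : ℝ} (hl : 0 < l) (f : ℕ → ℝ) :
    ∫ j, f j ∂truncPoisson k l = ∑' j, truncPoissonWeight k l j * f j := by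
  rw [truncPoisson, MeasureTheory.integral_sum_dirac fun _ => ENNReal.ofReal_ne_top]
  simp [ENNReal.toReal_ofReal, truncPoissonWeight_nonneg k hl]

lemma isProbabilityMeasure_truncPoisson (k : ℕ) {l : ℝ} (hl : 0 < l) :
    MeasureTheory.IsProbabilityMeasure (truncPoisson k l) := by
  have h := hasSum_truncPoissonWeight_mul_pow k l 1
  simp only [one_pow, mul_one, one_mul, div_self (fk_pos k hl).ne'] at h
  refine ⟨?_⟩
  rw [truncPoisson, MeasureTheory.Measure.sum_apply _ MeasurableSet.univ]
  simp only [MeasureTheory.Measure.smul_apply, MeasureTheory.measure_univ, smul_eq_mul, mul_one]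
  rw [← ENNReal.ofReal_tsum_of_nonneg (truncPoissonWeight_nonneg k hl) h.summable, h.tsum_eq,
    ENNReal.ofReal_one]

lemma measureReal_truncPoisson_singleton (k : ℕ) {l : ℝ} (hl : 0 < l) (n : ℕ) :
    (truncPoisson k l).real {n} = truncPoissonWeight k l n := by
  rw [← MeasureTheory.integral_indicator_one (measurableSet_singleton n),
    integral_truncPoisson k hl, tsum_eq_single n]
  · simp
  · intro b hb
    simp [hb]

lemma integrable_exp_truncPoisson (k : ℕ) {l : ℝ} (hl : 0 < l) (a : ℝ) :
    MeasureTheory.Integrable (fun n : ℕ => Real.exp (a * n)) (truncPoisson k l) := by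
  refine MeasureTheory.integrable_sum_dirac (fun _ => ENNReal.ofReal_ne_top) ?_
  convert! (hasSum_truncPoissonWeight_mul_pow k l (Real.exp a)).summable using 2 with j
  rw [ENNReal.toReal_ofReal (truncPoissonWeight_nonneg k hl j), Real.norm_eq_abs, Real.abs_exp,
    mul_comm a, Real.exp_nat_mul]

lemma integral_exp_truncPoisson_le (k : ℕ) {l : ℝ} (hl : 0 < l) {a : ℝ} :
    ∫ n : ℕ, Real.exp (a * n) ∂truncPoisson k l ≤ Real.exp (a * k + Real.exp a * l) := by
  have h := (hasSum_truncPoissonWeight_mul_pow k l (Real.exp a)).tsum_eq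
  simp only [← Real.exp_nat_mul, mul_comm _ a] at h
  have hf := fk_pos k hl
  rw [integral_truncPoisson k hl, h, div_le_iff₀ hf]
  refine (fk_le k (by positivity)).trans ?_
  rw [mul_pow, ← Real.exp_nat_mul, mul_comm _ a, Real.exp_add]
  calc _ = Real.exp (a * k) * Real.exp (Real.exp a * l) * (l ^ k / (Nat.factorial k : ℝ)) := by
        ring
    _ ≤ _ := by
        gcongr
        exact pow_div_factorial_le_fk k hl.le

open Classical in
lemma tsum_ite_prod_truncPoissonWeight (k N : ℕ) {l : ℝ} (hl : 0 < l)
    (P : (Fin N → ℕ) → (Fin N → ℕ) → Prop) :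
    (∑' y : (Fin N → ℕ) × (Fin N → ℕ), if P y.1 y.2 then
      (∏ i, truncPoissonWeight k l (y.1 i)) * (∏ i, truncPoissonWeight k l (y.2 i)) else 0) =
    (MeasureTheory.Measure.pi fun _ : Fin N => (truncPoisson k l).prod (truncPoisson k l)).real
      {ω | P (fun i => (ω i).1) (fun i => (ω i).2)} := by
  have := isProbabilityMeasure_truncPoisson k hl
  set S := {ω : Fin N → ℕ × ℕ | P (fun i => (ω i).1) (fun i => (ω i).2)}
  have hS : MeasurableSet S := S.to_countable.measurableSet
  rw [← MeasureTheory.integral_indicator_one hS, MeasureTheory.integral_countable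
    ((MeasureTheory.integrable_const 1).indicator hS),
    ← (Equiv.arrowProdEquivProdArrow (Fin N) (fun _ => ℕ) (fun _ => ℕ)).tsum_eq]
  refine tsum_congr fun ω => ?_
  simp only [Equiv.arrowProdEquivProdArrow_apply, Set.indicator_apply, S, Set.mem_ofPred_eq,
    smul_eq_mul, mul_ite, Pi.one_apply, mul_one, mul_zero]
  refine if_congr Iff.rfl ?_ rfl
  rw [MeasureTheory.measureReal_def, MeasureTheory.Measure.pi_singleton, ENNReal.toReal_prod,
    ← Finset.prod_mul_distrib]
  refine Finset.prod_congr rfl fun i _ => ?_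
  rw [← measureReal_truncPoisson_singleton k hl, ← measureReal_truncPoisson_singleton k hl,
    ← MeasureTheory.measureReal_prod_prod, Set.singleton_prod_singleton,
    MeasureTheory.measureReal_def]

open Classical in
/-- Let `Y₁⁺, …, Y_N⁺, Y₁⁻, …, Y_N⁻` be independent `TPo_k(λ)` random variables, `k ≥ 1`
fixed, `0 < λ ≤ log N`, and `c = E[Y₁⁺]`.  Then for any `t ≥ √N (log N)³`,
`P(|∑ Y_i⁺ Y_i⁻ - c² N| > t) = O(exp(-(t²/(8N))^{1/5}))` as `N → ∞`. -/
theorem stmt_19 (k : ℕ) (hk : 1 ≤ k) :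
    ∃ C₀ : ℝ, 0 < C₀ ∧ ∀ (N : ℕ) (l t : ℝ), 0 < l → l ≤ Real.log N →
      Real.sqrt N * (Real.log N) ^ 3 ≤ t →
      (∑' y : (Fin N → ℕ) × (Fin N → ℕ),
        if t < |(∑ i, ((y.1 i : ℝ) * (y.2 i : ℝ))) -
            (∑' j : ℕ, (j : ℝ) *
              (if k ≤ j then l ^ j / (fk k l * (Nat.factorial j : ℝ)) else 0)) ^ 2 * N| then
          (∏ i, (if k ≤ y.1 i then l ^ (y.1 i) / (fk k l * (Nat.factorial (y.1 i) : ℝ)) else 0)) *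
          (∏ i, (if k ≤ y.2 i then l ^ (y.2 i) / (fk k l * (Nat.factorial (y.2 i) : ℝ)) else 0))
        else 0)
      ≤ C₀ * Real.exp (-(t ^ 2 / (8 * N)) ^ ((1 : ℝ) / 5)) := by
  set K : ℝ := 2 * Real.exp 5 with hK
  have hK1 : 1 ≤ K := by linarith [Real.add_one_le_exp 5]
  set D₀ : ℝ := 8 * K ^ 6 + 5 * k with hD₀
  refine ⟨Real.exp D₀ + Real.exp (10 * k) + 2, by positivity, fun N l t hl hlN ht => ?_⟩
  have := isProbabilityMeasure_truncPoisson k hl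
  have hL : 0 < Real.log N := hl.trans_le hlN
  have hN : (1 : ℝ) ≤ N := by
    by_contra! h
    exact absurd hL (not_lt.mpr (Real.log_nonpos N.cast_nonneg h.le))
  have ht0 : 0 < t := lt_of_lt_of_le (by positivity) ht
  set D : ℝ := (t ^ 2 / (8 * N)) ^ ((1 : ℝ) / 5) with hD
  have hD0 : 0 < D := by positivity
  have hD5 : t ^ 2 = 8 * N * D ^ 5 := by
    have : D ^ 5 = t ^ 2 / (8 * N) := by
      rw [hD, ← Real.rpow_natCast, ← Real.rpow_mul (by positivity)]
      norm_num
    rw [this]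
    field_simp
  have hmean : ∑' j : ℕ, (j : ℝ) *
      (if k ≤ j then l ^ j / (fk k l * (Nat.factorial j : ℝ)) else 0) =
      ∫ n : ℕ, (n : ℝ) ∂truncPoisson k l := by
    rw [integral_truncPoisson k hl]
    exact tsum_congr fun j => mul_comm _ _
  rw [hmean]
  refine (tsum_ite_prod_truncPoissonWeight k N hl fun y z =>
    t < |(∑ i, ((y i : ℝ) * (z i : ℝ))) - (∫ n : ℕ, (n : ℝ) ∂truncPoisson k l) ^ 2 * N|).trans_le ?_
  rcases lt_or_ge D D₀ with hlt | hge
  · refine MeasureTheory.measureReal_le_one.trans ?_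
    have h1 : 1 ≤ Real.exp D₀ * Real.exp (-D) := by
      rw [← Real.exp_add]
      exact Real.one_le_exp (by linarith)
    have h2 : 0 ≤ (Real.exp (10 * k) + 2) * Real.exp (-D) := by positivity
    linarith
  have hk0 : (0 : ℝ) ≤ k := k.cast_nonneg
  have hK6 : 1 ≤ K ^ 6 := one_le_pow₀ hK1
  have hD1 : 1 ≤ D := by linarith
  have hL6 : Real.log N ^ 6 ≤ 8 * D ^ 5 := by
    have h1 : (Real.sqrt N * (Real.log N) ^ 3) ^ 2 ≤ t ^ 2 := by gcongr
    rw [mul_pow, Real.sq_sqrt N.cast_nonneg, hD5, ← pow_mul, mul_comm (8 : ℝ), mul_assoc] at h1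
    exact le_of_mul_le_mul_left h1 (by linarith)
  have hKL : K * Real.log N ≤ D := by
    by_contra! h
    have h1 : D ^ 6 < (K * Real.log N) ^ 6 := by gcongr
    have h2 : K ^ 6 * Real.log N ^ 6 ≤ K ^ 6 * (8 * D ^ 5) := by gcongr
    have h3 : 8 * K ^ 6 * D ^ 5 ≤ D * D ^ 5 := by
      gcongr
      linarith
    rw [mul_pow] at h1
    linarith [pow_succ' D 5]
  have hND : (N : ℝ) ≤ Real.exp D := by
    rw [← Real.exp_log (by linarith : (0 : ℝ) < N)]
    apply Real.exp_le_exp.mpr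
    nlinarith
  have hq : N * (Real.exp (-4 * D) * (∫ n : ℕ, Real.exp (5 * n) ∂truncPoisson k l) ^ 2) ≤
      Real.exp (10 * k - 2 * D) := by
    calc _ ≤ Real.exp D * (Real.exp (-4 * D) * (Real.exp (5 * k + Real.exp 5 * l)) ^ 2) := by
          have : 0 ≤ ∫ n : ℕ, Real.exp (5 * n) ∂truncPoisson k l :=
            MeasureTheory.integral_nonneg fun n => Real.exp_nonneg _
          gcongr
          exact integral_exp_truncPoisson_le k hl
      _ = Real.exp (10 * k - 3 * D + K * l) := by
          rw [← Real.exp_nat_mul, ← Real.exp_add, ← Real.exp_add]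
          congr 1
          push_cast
          ring
      _ ≤ _ := by
          apply Real.exp_le_exp.mpr
          have : K * l ≤ K * Real.log N := by gcongr
          linarith
  have ht2 : 1 ≤ t / 2 := by
    have h1 : 1 ≤ N * D ^ 5 := one_le_mul_of_one_le_of_one_le hN (one_le_pow₀ hD1)
    nlinarith
  have hqt := hq.trans ((Real.exp_le_one_iff.mpr (by linarith)).trans ht2)
  refine (measureReal_abs_sum_mul_sub_gt_le (truncPoisson k l) N hD0.le ht0.le
    (integrable_exp_truncPoisson k hl 5) hqt).trans ?_
  have hexp : -(t / 2) ^ 2 / (2 * (N * (D ^ 2 / 2) ^ 2)) = -4 * D := by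
    rw [div_pow, hD5]
    field_simp
    norm_num
  rw [hexp]
  have h1 : Real.exp (10 * k - 2 * D) ≤ Real.exp (10 * k) * Real.exp (-D) := by
    rw [← Real.exp_add]
    exact Real.exp_le_exp.mpr (by linarith)
  have h2 : Real.exp (-4 * D) ≤ Real.exp (-D) := Real.exp_le_exp.mpr (by linarith)
  have h3 : 0 ≤ Real.exp D₀ * Real.exp (-D) := by positivity
  linarith
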